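/- Let v be a nonzero real number and let (u_n) be a sequence of real numbers converging to v such that for all n, u_n ≠ v, u_n ≠ u_{n+1}, u_n + v ≠ 0, and u_n + u_{n+1} ≠ 0. If additionally the ratio (u_n − v)/(u_n − u_{n+1}) converges to 1 as n → ∞, then C_{u_n, v} − C_{u_n, u_{n+1}} → 0 as n → ∞; that is, the number of common significant digits between the approximation u_n and the exact value v is asymptotically equal to the number of common significant digits between the two successive approximations u_n and u_{n+1}. -/

import Mathlib

open Filter

/-- The number of common significant digits of two real numbers. -/
noncomputable def C (θ₁ θ₂ : ℝ) : ℝ :=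
  Real.logb 10 |(θ₁ + θ₂) / (2 * (θ₁ - θ₂))|

theorem stmt_9 (v : ℝ) (hv : v ≠ 0) (u : ℕ → ℝ)
    (hconv : Tendsto u atTop (nhds v))
    (hne : ∀ n, u n ≠ v) (hne' : ∀ n, u n ≠ u (n + 1))
    (hsum : ∀ n, u n + v ≠ 0) (hsum' : ∀ n, u n + u (n + 1) ≠ 0)
    (hratio : Tendsto (fun n => (u n - v) / (u n - u (n + 1))) atTop (nhds 1)) :
    Tendsto (fun n => C (u n) v - C (u n) (u (n + 1))) atTop (nhds 0) := by
  have hshift : Tendsto (fun n => u (n + 1)) atTop (nhds v) :=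
    hconv.comp (tendsto_add_atTop_nat 1)
  have hquot : Tendsto (fun n => (u n + v) / (u n + u (n + 1)) /
      ((u n - v) / (u n - u (n + 1)))) atTop (nhds 1) := by
    have hvv : v + v ≠ 0 := by simpa using hv
    have h := ((hconv.add_const v).div (hconv.add hshift) hvv).div hratio one_ne_zero
    rwa [div_self hvv, div_one] at h
  have hlog := (hquot.abs.log (by simp)).div_const (Real.log 10)
  simp only [abs_one, Real.log_one, zero_div] at hlog
  refine hlog.congr fun n => ?_
  have h₁ := sub_ne_zero.mpr (hne n)
  have h₂ := sub_ne_zero.mpr (hne' n)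
  have h₃ := hsum n
  have h₄ := hsum' n
  simp only [C, Real.logb, Real.log_abs]
  rw [← sub_div, ← Real.log_div (by positivity) (by positivity)]
  congr 2
  field_simp
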